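/- Let 0 < α ≤ 1. A real n×n matrix A is Metzler if and only if for every t ≥ 0 the Mittag-Leffler matrix function E_{α,1}(A t^α) = Σ_{ℓ=0}^∞ t^{αℓ} A^ℓ / Γ(αℓ + 1) is entrywise nonnegative. -/

import Mathlib

/-- A real `n × n` matrix is *Metzler* if all of its off-diagonal entries are nonnegative. -/
def Matrix.IsMetzler {n : ℕ} (A : Matrix (Fin n) (Fin n) ℝ) : Prop :=
  ∀ i j : Fin n, i ≠ j → 0 ≤ A i j

open Filter Topology

/-- Bound on the entries of the powers of a matrix. -/
lemma ml_pow_entry_bound {n : ℕ} (A : Matrix (Fin n) (Fin n) ℝ) :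
    ∃ C : ℝ, 0 < C ∧ ∀ k : ℕ, ∀ i j, |(A ^ k) i j| ≤ C ^ k := by
  refine ⟨(∑ i, ∑ j, |A i j|) + 1, by positivity, ?_⟩
  set M := ∑ i, ∑ j, |A i j| with hM
  have hM0 : 0 ≤ M := by positivity
  intro k
  induction k with
  | zero =>
    intro i j
    by_cases h : i = j
    · simp [h]
    · simp [Matrix.one_apply, h]
  | succ k ih =>
    intro i j
    rw [pow_succ, Matrix.mul_apply]
    have hcol : ∑ l, |A l j| ≤ M := by
      apply Finset.sum_le_sum
      intro l _
      exact Finset.single_le_sum (f := fun j => |A l j|) (fun _ _ => abs_nonneg _)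
        (Finset.mem_univ j)
    calc |∑ l, (A ^ k) i l * A l j| ≤ ∑ l, |(A ^ k) i l * A l j| :=
          Finset.abs_sum_le_sum_abs _ _
      _ ≤ ∑ l, (M + 1) ^ k * |A l j| := by
          apply Finset.sum_le_sum
          intro l _
          rw [abs_mul]
          exact mul_le_mul_of_nonneg_right (ih i l) (abs_nonneg _)
      _ = (M + 1) ^ k * ∑ l, |A l j| := by rw [Finset.mul_sum]
      _ ≤ (M + 1) ^ k * (M + 1) := by
          apply mul_le_mul_of_nonneg_left _ (by positivity)
          linarith
      _ = (M + 1) ^ (k + 1) := by rw [pow_succ]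

/-- Entrywise form of the exponential series. -/
lemma ml_exp_entry {n : ℕ} (A : Matrix (Fin n) (Fin n) ℝ) (i j : Fin n) :
    HasSum (fun k : ℕ => ((k.factorial : ℝ)⁻¹) * (A ^ k) i j) ((NormedSpace.exp A) i j) := by
  obtain ⟨C, hC, hb⟩ := ml_pow_entry_bound A
  have hs : Summable (fun k : ℕ => ((k.factorial : ℝ)⁻¹) • (A ^ k)) := by
    refine Pi.summable.mpr fun i => Pi.summable.mpr fun j => ?_
    refine Summable.of_norm_bounded (Real.summable_pow_div_factorial C) fun k => ?_
    have := hb k i j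
    rw [Matrix.smul_apply, smul_eq_mul, Real.norm_eq_abs, abs_mul, abs_of_nonneg (by positivity),
      div_eq_inv_mul]
    gcongr
  have h : HasSum (fun k : ℕ => ((k.factorial : ℝ)⁻¹) • (A ^ k)) (NormedSpace.exp A) := by
    rw [NormedSpace.exp_eq_tsum ℝ]
    exact hs.hasSum
  have := Pi.hasSum.mp (Pi.hasSum.mp h i) j
  simpa using this

lemma ml_pow_nonneg {n : ℕ} (B : Matrix (Fin n) (Fin n) ℝ) (hB : ∀ i j, 0 ≤ B i j) (k : ℕ) :
    ∀ i j, 0 ≤ (B ^ k) i j := by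
  induction k with
  | zero =>
    intro i j
    rw [pow_zero, Matrix.one_apply]
    split_ifs <;> norm_num
  | succ k ih =>
    intro i j
    rw [pow_succ, Matrix.mul_apply]
    exact Finset.sum_nonneg fun l _ => mul_nonneg (ih i l) (hB l j)

lemma ml_exp_nonneg {n : ℕ} (A : Matrix (Fin n) (Fin n) ℝ) (hA : A.IsMetzler) (i j : Fin n) :
    0 ≤ (NormedSpace.exp A) i j := by
  set c : ℝ := ∑ i, |A i i| with hc
  have hB : ∀ i j : Fin n, 0 ≤ (A + Matrix.diagonal (fun _ : Fin n => c) : Matrix (Fin n) (Fin n) ℝ) i j := by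
    intro i j
    by_cases h : i = j
    · subst h
      have h1 : |A i i| ≤ c :=
        Finset.single_le_sum (f := fun i => |A i i|) (fun _ _ => abs_nonneg _) (Finset.mem_univ i)
      have h2 := neg_abs_le (A i i)
      simp only [Matrix.add_apply, Matrix.diagonal_apply_eq]
      linarith
    · simpa [h] using hA i j h
  have hcomm : Commute (A + Matrix.diagonal (fun _ => c)) (Matrix.diagonal (fun _ : Fin n => -c)) := by
    have : (Matrix.diagonal (fun _ : Fin n => -c)) = Matrix.scalar (Fin n) (-c) := rfl
    rw [this]
    exact (Matrix.scalar_commute (-c) (fun r => Commute.all _ _) _).symm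
  have hdec : A = (A + Matrix.diagonal (fun _ => c)) + Matrix.diagonal (fun _ : Fin n => -c) := by
    rw [add_assoc, Matrix.diagonal_add]; simp
  rw [hdec, Matrix.exp_add_of_commute _ _ hcomm, Matrix.exp_diagonal, Matrix.mul_diagonal]
  refine mul_nonneg ?_ ?_
  · refine (ml_exp_entry _ i j).nonneg fun k => ?_
    exact mul_nonneg (by positivity) (ml_pow_nonneg _ hB k i j)
  · rw [Pi.coe_exp, ← Real.exp_eq_exp_ℝ]
    exact (Real.exp_pos _).le

lemma ml_exp_series_nonneg {n : ℕ} (A : Matrix (Fin n) (Fin n) ℝ) (hA : A.IsMetzler) (i j : Fin n)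
    (s : ℝ) (hs : 0 ≤ s) :
    0 ≤ ∑' k : ℕ, ((k.factorial : ℝ)⁻¹ * (A ^ k) i j) * s ^ k := by
  have h1 : (s • A).IsMetzler := fun i j h => by
    simpa using mul_nonneg hs (hA i j h)
  have h := ml_exp_nonneg (s • A) h1 i j
  rw [← (ml_exp_entry (s • A) i j).tsum_eq] at h
  convert h using 3 with k
  rw [smul_pow, Matrix.smul_apply, smul_eq_mul]
  ring

lemma ml_step (b : ℕ → ℝ) (hb : ∀ C : ℝ, 0 ≤ C → Summable fun k => |b k| * C ^ k)
    (hpos : ∀ s : ℝ, 0 ≤ s → 0 ≤ ∑' k, b k * s ^ k) (α : ℝ) (hα0 : 0 < α) (hα1 : α ≤ 1) (j : ℕ)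
    (s : ℝ) (hs : 0 ≤ s) :
    0 ≤ ∑' k : ℕ, (b k * ((α * k + 1 + j) / (k + 1 + j))) * s ^ k := by
  have hI : HasSum (fun k : ℕ => ∫ x in (0 : ℝ)..1, x ^ j * (b k * (s * x) ^ k))
      (∫ x in (0 : ℝ)..1, ∑' k : ℕ, x ^ j * (b k * (s * x) ^ k)) := by
    refine intervalIntegral.hasSum_intervalIntegral_of_summable_norm
      (f := fun k : ℕ => (⟨fun x : ℝ => x ^ j * (b k * (s * x) ^ k), by fun_prop⟩ : C(ℝ, ℝ))) ?_
    refine Summable.of_nonneg_of_le (fun _ => norm_nonneg _) (fun k => ?_) (hb s hs)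
    rw [ContinuousMap.norm_le _ (by positivity)]
    rintro ⟨x, hx⟩
    have hx : x ∈ Set.Icc (0:ℝ) 1 := by simpa using hx
    obtain ⟨hx0, hx1⟩ := hx
    simp only [ContinuousMap.restrict_apply, ContinuousMap.coe_mk, Real.norm_eq_abs, abs_mul,
      abs_pow, abs_of_nonneg hx0, abs_of_nonneg hs]
    have h1 : x ^ j ≤ 1 := pow_le_one₀ hx0 hx1
    have h2 : (s * x) ^ k ≤ s ^ k := pow_le_pow_left₀ (by positivity) (by nlinarith) k
    calc x ^ j * (|b k| * (s * x) ^ k) ≤ 1 * (|b k| * s ^ k) := by gcongr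
      _ = _ := one_mul _
  have hnn : 0 ≤ ∫ x in (0 : ℝ)..1, ∑' k : ℕ, x ^ j * (b k * (s * x) ^ k) := by
    apply intervalIntegral.integral_nonneg (by norm_num)
    rintro x ⟨hx0, hx1⟩
    rw [tsum_mul_left]
    exact mul_nonneg (by positivity) (hpos _ (by positivity))
  have hint : ∀ k : ℕ, ∫ x in (0 : ℝ)..1, x ^ j * (b k * (s * x) ^ k)
      = b k * s ^ k * (1 / (k + 1 + j)) := by
    intro k
    have : ∀ x : ℝ, x ^ j * (b k * (s * x) ^ k) = b k * s ^ k * x ^ (j + k) := by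
      intro x; rw [mul_pow, pow_add]; ring
    simp_rw [this]
    rw [intervalIntegral.integral_const_mul, integral_pow]
    simp
    left; ring
  simp_rw [hint] at hI
  have h0 : Summable fun k => b k * s ^ k := by
    refine Summable.of_norm_bounded (hb s hs) fun k => ?_
    rw [Real.norm_eq_abs, abs_mul, abs_pow, abs_of_nonneg hs]
  have := (h0.hasSum.mul_left α).add (hI.mul_left ((1 - α) * (j + 1)))
  have heq : ∀ k : ℕ, α * (b k * s ^ k) + (1 - α) * (j + 1) * (b k * s ^ k * (1 / (k + 1 + j)))
      = (b k * ((α * k + 1 + j) / (k + 1 + j))) * s ^ k := by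
    intro k
    have : (k + 1 + j : ℝ) ≠ 0 := by positivity
    field_simp
    ring
  simp_rw [heq] at this
  rw [this.tsum_eq]
  have h1 := hpos s hs
  have h2 : 0 ≤ 1 - α := by linarith
  positivity

/-- Partial products. -/
noncomputable def mlP (α : ℝ) (n k : ℕ) : ℝ :=
  ∏ j ∈ Finset.range n, (α * k + 1 + j) / (k + 1 + j)

lemma mlP_nonneg (α : ℝ) (hα0 : 0 < α) (n k : ℕ) : 0 ≤ mlP α n k :=
  Finset.prod_nonneg fun j _ => by positivity

lemma mlP_le_one (α : ℝ) (hα0 : 0 < α) (hα1 : α ≤ 1) (n k : ℕ) : mlP α n k ≤ 1 := by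
  refine Finset.prod_le_one (fun j _ => by positivity) fun j _ => ?_
  rw [div_le_one (by positivity)]
  have : (0:ℝ) ≤ k := by positivity
  nlinarith

lemma mlP_series_nonneg (b : ℕ → ℝ) (hb : ∀ C : ℝ, 0 ≤ C → Summable fun k => |b k| * C ^ k)
    (hpos : ∀ s : ℝ, 0 ≤ s → 0 ≤ ∑' k, b k * s ^ k) (α : ℝ) (hα0 : 0 < α) (hα1 : α ≤ 1) (n : ℕ) :
    ∀ (s : ℝ), 0 ≤ s → 0 ≤ ∑' k : ℕ, (b k * mlP α n k) * s ^ k := by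
  induction n with
  | zero => simpa [mlP] using hpos
  | succ n ih =>
    intro s hs
    have := ml_step (fun k => b k * mlP α n k) (fun C hC => ?_) ih α hα0 hα1 n s hs
    · simpa only [mlP, Finset.prod_range_succ, mul_assoc] using this
    · refine Summable.of_nonneg_of_le (fun _ => by positivity) (fun k => ?_) (hb C hC)
      rw [abs_mul, abs_of_nonneg (mlP_nonneg α hα0 n k)]
      have := mlP_le_one α hα0 hα1 n k
      gcongr
      exact mul_le_of_le_one_right (abs_nonneg _) this

lemma mlP_bound (α : ℝ) (hα0 : 0 < α) (hα1 : α ≤ 1) (n k : ℕ) :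
    mlP α n k * ((k : ℝ) + 1 + n) ^ ((1 - α) * k) ≤ ((k : ℝ) + 1) ^ ((1 - α) * k) := by
  induction n with
  | zero => simp [mlP]
  | succ n ih =>
    refine le_trans ?_ ih
    have hy : (0 : ℝ) < k + 1 + n := by positivity
    have hP := mlP_nonneg α hα0 n k
    set y : ℝ := k + 1 + n with hy'
    have h2 : 0 ≤ 1 - α := by linarith
    have hp : 0 ≤ (1 - α) * k := by positivity
    have e1 : mlP α (n + 1) k = mlP α n k * ((α * k + 1 + n) / y) := by
      simp only [mlP, Finset.prod_range_succ, hy']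
    have e2 : ((k : ℝ) + 1 + (n + 1 : ℕ)) = y * (1 + 1 / y) := by
      field_simp; rw [hy']; push_cast; ring
    rw [e1, e2, Real.mul_rpow hy.le (by positivity), mul_assoc]
    refine mul_le_mul_of_nonneg_left ?_ hP
    have f1 : (α * k + 1 + n) / y ≤ Real.exp (-((1 - α) * k * (1 / y))) := by
      have := Real.add_one_le_exp (-((1 - α) * k * (1 / y)))
      refine le_trans (le_of_eq ?_) this
      field_simp; rw [hy']; ring
    have f2 : (1 + 1 / y) ^ ((1 - α) * k) ≤ Real.exp ((1 - α) * k * (1 / y)) := by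
      have := Real.add_one_le_exp (1 / y)
      calc (1 + 1 / y) ^ ((1 - α) * k) ≤ (Real.exp (1 / y)) ^ ((1 - α) * k) :=
            Real.rpow_le_rpow (by positivity) (by linarith) hp
        _ = _ := by rw [← Real.exp_mul]; congr 1; ring
    have f3 : (α * k + 1 + n) / y * (1 + 1 / y) ^ ((1 - α) * k) ≤ 1 := by
      calc _ ≤ Real.exp (-((1 - α) * k * (1 / y))) * Real.exp ((1 - α) * k * (1 / y)) := by
            gcongr
        _ = 1 := by rw [← Real.exp_add]; simp
    have f4 : 0 ≤ y ^ ((1 - α) * k) := by positivity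
    calc _ = y ^ ((1 - α) * k) * ((α * k + 1 + n) / y * (1 + 1 / y) ^ ((1 - α) * k)) := by ring
      _ ≤ y ^ ((1 - α) * k) * 1 := by gcongr
      _ = _ := mul_one _

lemma ml_tendsto (α : ℝ) (hα0 : 0 < α) (k : ℕ) :
    Tendsto (fun n : ℕ => (k.factorial : ℝ)⁻¹ * mlP α (n + 1) k * ((n : ℝ) ^ (1 - α)) ^ k) atTop
      (𝓝 (1 / Real.Gamma (α * k + 1))) := by
  have hG : Real.Gamma (α * k + 1) ≠ 0 := (Real.Gamma_pos_of_pos (by positivity)).ne'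
  have h := (Real.GammaSeq_tendsto_Gamma ((k : ℝ) + 1)).div
    (Real.GammaSeq_tendsto_Gamma (α * k + 1)) hG
  have h := h.const_mul ((k.factorial : ℝ)⁻¹)
  rw [Real.Gamma_nat_eq_factorial] at h
  have e : (k.factorial : ℝ)⁻¹ * (k.factorial / Real.Gamma (α * k + 1))
      = 1 / Real.Gamma (α * k + 1) := by
    have : (k.factorial : ℝ) ≠ 0 := by positivity
    field_simp
  rw [e] at h
  refine h.congr' ?_
  filter_upwards [eventually_gt_atTop 0] with n hn
  have hn' : (0 : ℝ) < n := by exact_mod_cast hn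
  rw [mul_assoc]
  congr 1
  simp only [Pi.div_apply, Real.GammaSeq, mlP, Finset.prod_div_distrib]
  have p1 : 0 < ∏ j ∈ Finset.range (n + 1), (α * k + 1 + j : ℝ) :=
    Finset.prod_pos fun j _ => by positivity
  have p2 : 0 < ∏ j ∈ Finset.range (n + 1), (k + 1 + j : ℝ) :=
    Finset.prod_pos fun j _ => by positivity
  have e3 : (n : ℝ) ^ ((k : ℝ) + 1) = (n : ℝ) ^ (α * k + 1) * ((n : ℝ) ^ (1 - α)) ^ k := by
    rw [← Real.rpow_natCast ((n : ℝ) ^ (1 - α)), ← Real.rpow_mul hn'.le, ← Real.rpow_add hn']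
    congr 1; ring
  have p3 : 0 < (n : ℝ) ^ (α * k + 1) := by positivity
  have p4 : (n.factorial : ℝ) ≠ 0 := by positivity
  rw [e3]
  field_simp

/-- The dominating sequence. -/
noncomputable def mlD (α : ℝ) (k : ℕ) : ℝ := (k.factorial : ℝ)⁻¹ * ((k : ℝ) + 1) ^ ((1 - α) * k)

lemma mlD_nonneg (α : ℝ) (k : ℕ) : 0 ≤ mlD α k := by unfold mlD; positivity

lemma mlD_summable (α : ℝ) (hα0 : 0 < α) (hα1 : α ≤ 1) (C : ℝ) (hC : 0 < C) :
    Summable fun k => mlD α k * C ^ k := by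
  have h2 : 0 ≤ 1 - α := by linarith
  set E : ℝ := Real.exp (1 - α) with hE
  have hE0 : 0 < E := Real.exp_pos _
  have key : ∀ k : ℕ, mlD α k ≤ E * (E ^ k * ((k.factorial : ℝ) ^ α)⁻¹) := by
    intro k
    have hf : (0 : ℝ) < k.factorial := by positivity
    have h3 : ((k : ℝ) + 1) ^ k ≤ k.factorial * Real.exp (k + 1) := by
      have := Real.pow_div_factorial_le_exp ((k : ℝ) + 1) (by positivity) k
      rwa [div_le_iff₀' hf] at this
    have h4 : ((k : ℝ) + 1) ^ ((1 - α) * k) ≤ (k.factorial : ℝ) ^ (1 - α) * (E * E ^ k) := by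
      calc ((k : ℝ) + 1) ^ ((1 - α) * k) = (((k : ℝ) + 1) ^ k) ^ (1 - α) := by
            rw [← Real.rpow_natCast, ← Real.rpow_mul (by positivity), mul_comm]
        _ ≤ (k.factorial * Real.exp (k + 1)) ^ (1 - α) :=
            Real.rpow_le_rpow (by positivity) h3 h2
        _ = _ := by
            rw [Real.mul_rpow hf.le (Real.exp_pos _).le, hE, ← Real.exp_mul, ← Real.exp_nat_mul,
              ← Real.exp_add]
            congr 2; ring
    unfold mlD
    calc _ ≤ (k.factorial : ℝ)⁻¹ * ((k.factorial : ℝ) ^ (1 - α) * (E * E ^ k)) := by gcongr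
      _ = _ := by
        rw [Real.rpow_sub hf, Real.rpow_one]
        have : 0 < (k.factorial : ℝ) ^ α := by positivity
        field_simp
  have hs : Summable fun k : ℕ => (E * C) ^ k * ((k.factorial : ℝ) ^ α)⁻¹ := by
    refine summable_of_ratio_test_tendsto_lt_one (l := 0) (by norm_num)
      (Eventually.of_forall fun k => by positivity) ?_
    have ht : Tendsto (fun k : ℕ => E * C * (((k : ℝ) + 1) ^ α)⁻¹) atTop (𝓝 0) := by
      have h1 : Tendsto (fun k : ℕ => ((k : ℝ) + 1)) atTop atTop :=
        tendsto_atTop_add_const_right _ _ tendsto_natCast_atTop_atTop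
      have := (((tendsto_rpow_atTop hα0).comp h1).inv_tendsto_atTop).const_mul (E * C)
      simpa using this
    refine ht.congr fun k => ?_
    have hf : (0 : ℝ) < k.factorial := by positivity
    rw [Real.norm_of_nonneg (by positivity), Real.norm_of_nonneg (by positivity),
      Nat.factorial_succ]
    push_cast
    rw [Real.mul_rpow (by positivity) hf.le, pow_succ]
    have : 0 < (k.factorial : ℝ) ^ α := by positivity
    have : 0 < ((k : ℝ) + 1) ^ α := by positivity
    field_simp
  refine Summable.of_nonneg_of_le (fun k => mul_nonneg (mlD_nonneg α k) (by positivity))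
    (fun k => ?_) (hs.mul_left E)
  calc _ ≤ E * (E ^ k * ((k.factorial : ℝ) ^ α)⁻¹) * C ^ k := by
        gcongr; exact key k
    _ = _ := by rw [mul_pow]; ring

lemma ml_dom (α : ℝ) (hα0 : 0 < α) (hα1 : α ≤ 1) (n k : ℕ) :
    (k.factorial : ℝ)⁻¹ * mlP α (n + 1) k * ((n : ℝ) ^ (1 - α)) ^ k ≤ mlD α k := by
  have h2 : 0 ≤ 1 - α := by linarith
  have hb := mlP_bound α hα0 hα1 (n + 1) k
  have hP := mlP_nonneg α hα0 (n + 1) k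
  unfold mlD
  rw [mul_assoc]
  refine mul_le_mul_of_nonneg_left (le_trans ?_ hb) (by positivity)
  refine mul_le_mul_of_nonneg_left ?_ hP
  rw [← Real.rpow_natCast, ← Real.rpow_mul (by positivity)]
  refine Real.rpow_le_rpow (by positivity) ?_ (by positivity)
  push_cast
  have : (0 : ℝ) ≤ k := by positivity
  linarith

lemma ml_coeff_le (α : ℝ) (hα0 : 0 < α) (hα1 : α ≤ 1) (k : ℕ) :
    1 / Real.Gamma (α * k + 1) ≤ mlD α k :=
  le_of_tendsto (ml_tendsto α hα0 k) (Eventually.of_forall fun n => ml_dom α hα0 hα1 n k)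

lemma ml_coeff_pos (α : ℝ) (hα0 : 0 < α) (k : ℕ) : 0 < 1 / Real.Gamma (α * k + 1) :=
  one_div_pos.mpr (Real.Gamma_pos_of_pos (by positivity))

lemma ml_series_nonneg (a : ℕ → ℝ) (C : ℝ) (hC : 0 < C) (ha : ∀ k, |a k| ≤ C ^ k)
    (hpos : ∀ s : ℝ, 0 ≤ s → 0 ≤ ∑' k : ℕ, ((k.factorial : ℝ)⁻¹ * a k) * s ^ k)
    (α : ℝ) (hα0 : 0 < α) (hα1 : α ≤ 1) (s : ℝ) (hs : 0 ≤ s) :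
    0 ≤ ∑' k : ℕ, (1 / Real.Gamma (α * k + 1)) * a k * s ^ k := by
  have hb : ∀ D : ℝ, 0 ≤ D → Summable fun k : ℕ => |(k.factorial : ℝ)⁻¹ * a k| * D ^ k := by
    intro D hD
    refine Summable.of_nonneg_of_le (fun _ => by positivity) (fun k => ?_)
      (Real.summable_pow_div_factorial (C * D))
    rw [abs_mul, abs_of_nonneg (by positivity), mul_pow, div_eq_inv_mul, mul_assoc]
    have := ha k
    gcongr
  have hn : ∀ n : ℕ, 0 ≤ ∑' k : ℕ,
      ((k.factorial : ℝ)⁻¹ * mlP α (n + 1) k * ((n : ℝ) ^ (1 - α)) ^ k) * (a k * s ^ k) := by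
    intro n
    have := mlP_series_nonneg _ hb hpos α hα0 hα1 (n + 1) ((n : ℝ) ^ (1 - α) * s) (by positivity)
    convert this using 3 with k
    rw [mul_pow]; ring
  have ht : Tendsto (fun n : ℕ => ∑' k : ℕ,
      ((k.factorial : ℝ)⁻¹ * mlP α (n + 1) k * ((n : ℝ) ^ (1 - α)) ^ k) * (a k * s ^ k)) atTop
      (𝓝 (∑' k : ℕ, (1 / Real.Gamma (α * k + 1)) * (a k * s ^ k))) := by
    refine tendsto_tsum_of_dominated_convergence
      (mlD_summable α hα0 hα1 (C * (s + 1)) (by positivity))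
      (fun k => (ml_tendsto α hα0 k).mul_const _) (Eventually.of_forall fun n k => ?_)
    have h1 := ml_dom α hα0 hα1 n k
    have hP := mlP_nonneg α hα0 (n + 1) k
    have h3 := ha k
    have h4 := mlD_nonneg α k
    rw [Real.norm_eq_abs, abs_mul, abs_of_nonneg (by positivity), abs_mul, abs_pow,
      abs_of_nonneg hs, mul_pow]
    gcongr
    linarith
  have := ge_of_tendsto' ht hn
  simpa only [mul_assoc] using this

lemma ml_entry_summable (a : ℕ → ℝ) (C : ℝ) (hC : 0 < C) (ha : ∀ k, |a k| ≤ C ^ k)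
    (α : ℝ) (hα0 : 0 < α) (hα1 : α ≤ 1) (s : ℝ) (hs : 0 ≤ s) :
    Summable fun k : ℕ => |(1 / Real.Gamma (α * k + 1)) * a k| * s ^ k := by
  refine Summable.of_nonneg_of_le (fun _ => by positivity) (fun k => ?_)
    (mlD_summable α hα0 hα1 (C * (s + 1)) (by positivity))
  have h1 := ml_coeff_le α hα0 hα1 k
  have h2 := ml_coeff_pos α hα0 k
  have h3 := ha k
  have h4 := mlD_nonneg α k
  rw [abs_mul, abs_of_nonneg h2.le, mul_pow, mul_assoc]
  gcongr
  linarith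

lemma ml_entry {n : ℕ} (A : Matrix (Fin n) (Fin n) ℝ)
    (α : ℝ) (hα0 : 0 < α) (hα1 : α ≤ 1) (t : ℝ) (ht : 0 ≤ t) (i j : Fin n) :
    (∑' ℓ : ℕ, (t ^ (α * ℓ) / Real.Gamma (α * ℓ + 1)) • A ^ ℓ) i j
      = ∑' k : ℕ, (1 / Real.Gamma (α * k + 1)) * (A ^ k) i j * (t ^ α) ^ k := by
  obtain ⟨C, hC, hb⟩ := ml_pow_entry_bound A
  have he : ∀ (i j : Fin n) (k : ℕ), ((t ^ (α * k) / Real.Gamma (α * k + 1)) • A ^ k) i j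
      = (1 / Real.Gamma (α * k + 1)) * (A ^ k) i j * (t ^ α) ^ k := by
    intro i j k
    rw [Matrix.smul_apply, smul_eq_mul, Real.rpow_mul ht, Real.rpow_natCast]
    ring
  have hs : Summable (fun k : ℕ => (t ^ (α * k) / Real.Gamma (α * k + 1)) • A ^ k) := by
    refine Pi.summable.mpr fun i => Pi.summable.mpr fun j => ?_
    refine (Summable.of_norm_bounded (ml_entry_summable (fun k => (A ^ k) i j) C hC
      (fun k => hb k i j) α hα0 hα1 (t ^ α) (by positivity)) fun k => ?_)
    rw [he, Real.norm_eq_abs, abs_mul _ ((t ^ α) ^ k), abs_of_nonneg (by positivity : 0 ≤ (t ^ α) ^ k)]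
  have := Pi.hasSum.mp (Pi.hasSum.mp hs.hasSum i) j
  rw [← this.tsum_eq]
  exact tsum_congr fun k => he i j k

lemma ml_first_coeff (c : ℕ → ℝ) (hc : Summable fun k => |c k|) (h0 : c 0 = 0)
    (hpos : ∀ x : ℝ, 0 ≤ x → 0 ≤ ∑' k, c k * x ^ k) : 0 ≤ c 1 := by
  set K := ∑' k, |c (k + 2)| with hK
  have hcK : Summable fun k => |c (k + 2)| := (summable_nat_add_iff 2).mpr hc
  have key : ∀ x : ℝ, 0 < x → x ≤ 1 → 0 ≤ c 1 + x * K := by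
    intro x hx hx1
    have hs : Summable fun k => c k * x ^ k := by
      refine Summable.of_norm_bounded hc fun k => ?_
      rw [Real.norm_eq_abs, abs_mul, abs_of_nonneg (by positivity : 0 ≤ x ^ k)]
      exact mul_le_of_le_one_right (abs_nonneg _) (pow_le_one₀ hx.le hx1)
    have h1 := hpos x hx.le
    rw [← hs.sum_add_tsum_nat_add 2] at h1
    simp only [Finset.sum_range_succ, Finset.sum_range_zero, h0] at h1
    have h2 : ∑' k, c (k + 2) * x ^ (k + 2) ≤ x ^ 2 * K := by
      rw [hK, ← tsum_mul_left]
      refine Summable.tsum_le_tsum (fun k => ?_) ((summable_nat_add_iff 2).mpr hs)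
        (hcK.mul_left _)
      have e1 : c (k + 2) * x ^ (k + 2) ≤ |c (k + 2)| * x ^ (k + 2) := by
        gcongr; exact le_abs_self _
      have e2 : x ^ (k + 2) ≤ x ^ 2 := pow_le_pow_of_le_one hx.le hx1 (by omega)
      calc _ ≤ |c (k + 2)| * x ^ (k + 2) := e1
        _ ≤ |c (k + 2)| * x ^ 2 := by gcongr
        _ = _ := mul_comm _ _
    have h3 : 0 ≤ x * (c 1 + x * K) := by nlinarith
    exact nonneg_of_mul_nonneg_right h3 hx
  have ht : Tendsto (fun x : ℝ => c 1 + x * K) (𝓝[>] 0) (𝓝 (c 1)) := by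
    have : Tendsto (fun x : ℝ => c 1 + x * K) (𝓝 0) (𝓝 (c 1 + 0 * K)) :=
      Continuous.tendsto (by fun_prop) 0
    simpa using this.mono_left nhdsWithin_le_nhds
  refine ge_of_tendsto ht ?_
  filter_upwards [Ioc_mem_nhdsGT (show (0 : ℝ) < 1 by norm_num)] with x hx
  exact key x hx.1 hx.2

/-- Let `0 < α ≤ 1`.  A real `n × n` matrix `A` is Metzler if and only if for
every `t ≥ 0` the Mittag-Leffler matrix function
`E_{α,1}(A t^α) = Σ_{ℓ} (t^(αℓ) / Γ(αℓ + 1)) • A^ℓ` is entrywise nonnegative. -/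
theorem metzler_iff_mittagLeffler_nonneg {n : ℕ} (A : Matrix (Fin n) (Fin n) ℝ)
    (α : ℝ) (hα0 : 0 < α) (hα1 : α ≤ 1) :
    A.IsMetzler ↔
      ∀ t : ℝ, 0 ≤ t → ∀ i j : Fin n,
        0 ≤ (∑' ℓ : ℕ, (t ^ (α * ℓ) / Real.Gamma (α * ℓ + 1)) • A ^ ℓ) i j := by
  obtain ⟨C, hC, hb⟩ := ml_pow_entry_bound A
  constructor
  · intro hA t ht i j
    rw [ml_entry A α hα0 hα1 t ht]
    exact ml_series_nonneg (fun k => (A ^ k) i j) C hC (fun k => hb k i j)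
      (ml_exp_series_nonneg A hA i j) α hα0 hα1 (t ^ α) (by positivity)
  · intro h i j hij
    have h1 := ml_first_coeff (fun k : ℕ => (1 / Real.Gamma (α * k + 1)) * (A ^ k) i j) ?_ ?_ ?_
    · have h2 := ml_coeff_pos α hα0 1
      simp only [pow_one] at h1
      exact nonneg_of_mul_nonneg_right h1 h2
    · simpa using ml_entry_summable (fun k => (A ^ k) i j) C hC
        (fun k => hb k i j) α hα0 hα1 1 (by norm_num)
    · simp [Matrix.one_apply, hij]
    · intro x hx
      have h3 := h (x ^ (α⁻¹)) (by positivity) i j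
      rw [ml_entry A α hα0 hα1 _ (by positivity), ← Real.rpow_mul hx, inv_mul_cancel₀ hα0.ne',
        Real.rpow_one] at h3
      exact h3
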